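/- arXiv:2401.03383 — 8 statements merged into one kernel-verified Lean document; each statement's English description precedes it below -/
import Mathlib

section
/- For all integers k, ℓ with 0 ≤ k ≤ ℓ, the following identity holds in the integers: C(2ℓ, 2k) · Σ_{a=0}^{ℓ} (−1)^{k−a} · 4^{ℓ−a} · C(2a, a) · C(ℓ−k, ℓ−a) = C(ℓ, k) · C(2ℓ, ℓ). Equivalently, Σ_{a=0}^{ℓ} (−1)^{k−a} 4^{ℓ−a} C(2a, a) C(ℓ−k, ℓ−a) = C(ℓ, k)·C(2ℓ, ℓ) / C(2ℓ, 2k). -/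
open Finset

open Nat in
/-- The alternating binomial transform of the central binomial coefficients is given by the
super-Catalan numbers `(2k)! (2m)! / (k! m! (k + m)!)`. -/
theorem sum_antidiagonal_centralBinom_mul_factorial (k m : ℕ) :
    (∑ ij ∈ antidiagonal m, (m.choose ij.1 : ℤ) *
        ((-1) ^ ij.1 * 4 ^ ij.2 * ((2 * (k + ij.1)).choose (k + ij.1) : ℤ))) *
      (k ! * m ! * (k + m)!) = (2 * k)! * (2 * m)! := by
  induction m generalizing k with
  | zero =>
    have h := Nat.choose_mul_factorial_mul_factorial (show k ≤ 2 * k by lia)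
    rw [show 2 * k - k = k by lia] at h
    zify at h
    simp
    linear_combination h
  | succ m ih =>
    rw [Finset.sum_antidiagonal_choose_succ_mul
      (fun i j => (-1 : ℤ) ^ i * 4 ^ j * ((2 * (k + i)).choose (k + i) : ℤ)) m]
    have h₀ := ih k
    have h₁ := ih (k + 1)
    have e₀ : ∑ ij ∈ antidiagonal m, (m.choose ij.1 : ℤ) *
        ((-1) ^ ij.1 * 4 ^ (ij.2 + 1) * ((2 * (k + ij.1)).choose (k + ij.1) : ℤ)) =
        4 * ∑ ij ∈ antidiagonal m, (m.choose ij.1 : ℤ) *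
        ((-1) ^ ij.1 * 4 ^ ij.2 * ((2 * (k + ij.1)).choose (k + ij.1) : ℤ)) := by
      rw [Finset.mul_sum]
      exact Finset.sum_congr rfl fun _ _ => by ring
    have e₁ : ∑ ij ∈ antidiagonal m, (m.choose ij.2 : ℤ) *
        ((-1) ^ (ij.1 + 1) * 4 ^ ij.2 *
          ((2 * (k + (ij.1 + 1))).choose (k + (ij.1 + 1)) : ℤ)) =
        -∑ ij ∈ antidiagonal m, (m.choose ij.1 : ℤ) *
        ((-1) ^ ij.1 * 4 ^ ij.2 * ((2 * (k + 1 + ij.1)).choose (k + 1 + ij.1) : ℤ)) := by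
      rw [← Finset.sum_neg_distrib]
      refine Finset.sum_congr rfl fun ij h => ?_
      rw [Nat.choose_symm_of_eq_add (mem_antidiagonal.mp h).symm,
        show k + (ij.1 + 1) = k + 1 + ij.1 by lia]
      ring
    rw [e₀, e₁]
    generalize (∑ ij ∈ antidiagonal m, (m.choose ij.1 : ℤ) *
        ((-1) ^ ij.1 * 4 ^ ij.2 * ((2 * (k + ij.1)).choose (k + ij.1) : ℤ))) = x at *
    generalize (∑ ij ∈ antidiagonal m, (m.choose ij.1 : ℤ) *
        ((-1) ^ ij.1 * 4 ^ ij.2 * ((2 * (k + 1 + ij.1)).choose (k + 1 + ij.1) : ℤ))) = y at *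
    rw [show k + 1 + m = k + m + 1 by lia, show 2 * (k + 1) = 2 * k + 1 + 1 by lia] at h₁
    rw [show k + (m + 1) = k + m + 1 by lia, show 2 * (m + 1) = 2 * m + 1 + 1 by lia]
    simp only [Nat.factorial_succ] at h₁ ⊢
    push_cast at h₁ ⊢
    have hk : (k : ℤ) + 1 ≠ 0 := by positivity
    apply mul_left_cancel₀ hk
    linear_combination 4 * ((k : ℤ) + 1) * (m + 1) * (k + m + 1) * h₀ - ((m : ℤ) + 1) * h₁

/-- Dropping the vanishing terms `a < k` and substituting `a = k + j`. -/
theorem sum_range_centralBinom_eq_sum_antidiagonal (k m : ℕ) :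
    ∑ a ∈ range (k + m + 1),
        (-1 : ℤ) ^ (k + a) * 4 ^ (k + m - a) * ((2 * a).choose a : ℤ) *
          ((k + m - k).choose (k + m - a) : ℤ) =
      ∑ ij ∈ antidiagonal m, (m.choose ij.1 : ℤ) *
        ((-1) ^ ij.1 * 4 ^ ij.2 * ((2 * (k + ij.1)).choose (k + ij.1) : ℤ)) := by
  rw [add_assoc, Finset.sum_range_add, Finset.sum_eq_zero, zero_add,
    Finset.Nat.sum_antidiagonal_eq_sum_range_succ_mk]
  · refine Finset.sum_congr rfl fun j hj => ?_
    have hjm : j ≤ m := by simpa [Nat.lt_succ_iff] using hj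
    rw [show k + m - (k + j) = m - j by lia, show k + m - k = m by lia,
      Nat.choose_symm hjm, ← add_assoc, pow_add, Even.neg_one_pow (Even.add_self k)]
    ring
  · intro a ha
    have hak := Finset.mem_range.mp ha
    rw [Nat.choose_eq_zero_of_lt (show k + m - k < k + m - a by lia)]
    simp

/-- Lemma 6.1 of the paper: for `0 ≤ k ≤ ℓ`,
`C(2ℓ,2k) · Σ_{a=0}^{ℓ} (−1)^{k−a} 4^{ℓ−a} C(2a,a) C(ℓ−k,ℓ−a) = C(ℓ,k)·C(2ℓ,ℓ)`
as an identity of integers.  Here `(−1)^{k−a}` is written as `(−1)^{k+a}`,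
which agrees with it since the two exponents have the same parity. -/
theorem stmt2 (k ℓ : ℕ) (hk : k ≤ ℓ) :
    ((2 * ℓ).choose (2 * k) : ℤ) *
        ∑ a ∈ range (ℓ + 1),
          (-1 : ℤ) ^ (k + a) * 4 ^ (ℓ - a) * ((2 * a).choose a : ℤ) *
            ((ℓ - k).choose (ℓ - a) : ℤ) =
      (ℓ.choose k : ℤ) * ((2 * ℓ).choose ℓ : ℤ) := by
  obtain ⟨m, rfl⟩ := Nat.exists_eq_add_of_le hk
  rw [sum_range_centralBinom_eq_sum_antidiagonal]
  have h := sum_antidiagonal_centralBinom_mul_factorial k m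
  generalize (∑ ij ∈ antidiagonal m, (m.choose ij.1 : ℤ) *
    ((-1) ^ ij.1 * 4 ^ ij.2 * ((2 * (k + ij.1)).choose (k + ij.1) : ℤ))) = x at *
  have h₁ := Nat.choose_mul_factorial_mul_factorial (show 2 * k ≤ 2 * (k + m) by lia)
  have h₂ := Nat.choose_mul_factorial_mul_factorial (show k ≤ k + m by lia)
  have h₃ := Nat.choose_mul_factorial_mul_factorial (show k + m ≤ 2 * (k + m) by lia)
  rw [show 2 * (k + m) - 2 * k = 2 * m by lia] at h₁
  rw [show k + m - k = m by lia] at h₂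
  rw [show 2 * (k + m) - (k + m) = k + m by lia] at h₃
  zify at h₁ h₂ h₃
  have hne : (k.factorial * m.factorial * (k + m).factorial : ℤ) ≠ 0 := by positivity
  apply mul_right_cancel₀ hne
  linear_combination ((2 * (k + m)).choose (2 * k) : ℤ) * h + h₁ - h₃ -
    ((2 * (k + m)).choose (k + m) : ℤ) * (k + m).factorial * h₂
end

section
/- Fix a natural number k. For every real number x with |x| < 1/4, the series Σ_{ℓ ≥ 0} ((2ℓ+1)/(2k+1)) · C(ℓ, k) · C(2ℓ, ℓ) · x^ℓ converges, with sum equal to C(2k, k) · x^k / (1 − 4x)^{k + 3/2}. (Formally: the function ℓ ↦ ((2ℓ+1)/(2k+1))·C(ℓ,k)·C(2ℓ,ℓ)·x^ℓ has sum C(2k,k)·x^k·(1−4x)^{−(k+3/2)}, where the fractional power is the real power (1−4x)^{k+3/2} with 1−4x > 0.) -/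
theorem Ring.succ_mul_multichoose_succ (a : ℝ) (n : ℕ) :
    (n + 1 : ℝ) * Ring.multichoose a (n + 1) = (a + n) * Ring.multichoose a n := by
  have h₀ := Ring.factorial_nsmul_multichoose_eq_ascPochhammer a n
  have h₁ := Ring.factorial_nsmul_multichoose_eq_ascPochhammer a (n + 1)
  rw [Polynomial.ascPochhammer_smeval_eq_eval] at h₀ h₁
  rw [ascPochhammer_succ_eval, ← h₀] at h₁
  simp only [nsmul_eq_mul, Nat.factorial_succ, Nat.cast_mul, Nat.cast_succ] at h₁
  have hn : (n.factorial : ℝ) ≠ 0 := Nat.cast_ne_zero.mpr n.factorial_ne_zero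
  apply mul_left_cancel₀ hn
  linear_combination h₁

theorem Ring.centralBinom_mul_multichoose_add_three_halves (k n : ℕ) :
    (2 * (n + k) + 1 : ℝ) * (n + k).choose k * (n + k).centralBinom =
      (2 * k + 1) * k.centralBinom * (Ring.multichoose ((k : ℝ) + 3 / 2) n * 4 ^ n) := by
  induction n with
  | zero => simp
  | succ n ih =>
    have hm := Ring.succ_mul_multichoose_succ ((k : ℝ) + 3 / 2) n
    have hb : ((n + k + 1 : ℕ) : ℝ) * (n + k + 1).centralBinom =
        2 * (2 * (n + k) + 1) * (n + k).centralBinom := by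
      exact_mod_cast Nat.succ_mul_centralBinom_succ (n + k)
    have hc : ((n + k).choose k : ℝ) * (n + k + 1) = (n + k + 1).choose k * (n + 1) := by
      have h := Nat.choose_mul_succ_eq (n + k) k
      rw [show n + k + 1 - k = n + 1 by omega] at h
      exact_mod_cast h
    rw [show n + 1 + k = n + k + 1 by omega]
    have hn : (n + 1 : ℝ) ≠ 0 := by positivity
    apply mul_left_cancel₀ hn
    push_cast at hb ⊢
    linear_combination
      (-(2 * (n + k) + 3 : ℝ) * (n + k + 1).centralBinom) * hc +
      ((2 * (n + k) + 3 : ℝ) * (n + k).choose k) * hb +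
      (2 * (2 * (n + k) + 3 : ℝ)) * ih -
      ((2 * k + 1 : ℝ) * k.centralBinom * 4 ^ (n + 1)) * hm

theorem Real.hasSum_multichoose_mul_pow (a : ℝ) {y : ℝ} (hy : |y| < 1) :
    HasSum (fun n ↦ Ring.multichoose a n * y ^ n) (1 / (1 - y) ^ a) := by
  have hy' : y ∈ Metric.eball (0 : ℝ) 1 := by
    rw [← ENNReal.ofReal_one, Metric.eball_ofReal]
    simpa using hy
  simpa [FormalMultilinearSeries.ofScalars, Ring.multichoose_eq] using
    (Real.one_div_one_sub_rpow_hasFPowerSeriesOnBall_zero a).hasSum hy'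

/-- Lemma 6.2 of the paper: for a fixed natural number `k` and `|x| < 1/4`,
`Σ_{ℓ ≥ 0} ((2ℓ+1)/(2k+1)) C(ℓ,k) C(2ℓ,ℓ) x^ℓ = C(2k,k) x^k / (1−4x)^{k+3/2}`,
where the fractional power is the real power of the positive base `1 − 4x`. -/
theorem stmt3 (k : ℕ) (x : ℝ) (hx : |x| < 1 / 4) :
    HasSum
      (fun ℓ : ℕ =>
        (2 * ℓ + 1 : ℝ) / (2 * k + 1) * (ℓ.choose k : ℝ) * ((2 * ℓ).choose ℓ : ℝ) * x ^ ℓ)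
      (((2 * k).choose k : ℝ) * x ^ k / (1 - 4 * x) ^ ((k : ℝ) + 3 / 2)) := by
  have hy : |4 * x| < 1 := by
    rw [abs_mul, abs_of_pos (by norm_num : (0 : ℝ) < 4)]
    linarith
  have hs := (Real.hasSum_multichoose_mul_pow ((k : ℝ) + 3 / 2) hy).mul_left
    (((2 * k).choose k : ℝ) * x ^ k)
  rw [mul_one_div] at hs
  rw [← (add_left_injective k).hasSum_iff]
  · refine (congrArg (HasSum · _) (funext fun n ↦ ?_)).mpr hs
    have h := Ring.centralBinom_mul_multichoose_add_three_halves k n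
    simp only [Nat.centralBinom_eq_two_mul_choose] at h
    simp only [Function.comp_apply, Nat.cast_add]
    have hk : (2 * k + 1 : ℝ) ≠ 0 := by positivity
    rw [div_mul_eq_mul_div, div_mul_eq_mul_div, h]
    field_simp
    ring
  · intro ℓ hℓ
    have : ℓ < k := by
      by_contra! h
      exact hℓ ⟨ℓ - k, Nat.sub_add_cancel h⟩
    simp [Nat.choose_eq_zero_of_lt this]
end

section
/- Let ℓ be a natural number and let x, y be elements of a commutative ring. Then (x − y) · Σ_{p=0}^{2ℓ} Σ_{q=0}^{2ℓ} C(2ℓ+1, p+q+1) · x^p · y^q = (x+1)^{2ℓ+1} − (y+1)^{2ℓ+1}. (Terms with p + q + 1 > 2ℓ + 1 vanish since the binomial coefficient is 0, so the double sum over all p, q ≥ 0 is finite and equals the sum over 0 ≤ p, q ≤ 2ℓ.) -/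
open Finset

/-- Multiplying `∑ c (p + q + 1) x ^ p y ^ q` over a square by `x - y` telescopes to
boundary terms. -/
theorem sub_mul_sum_range_sum_range {R : Type*} [CommRing R] (c : ℕ → R) (N : ℕ) (x y : R) :
    (x - y) * ∑ p ∈ range N, ∑ q ∈ range N, c (p + q + 1) * x ^ p * y ^ q =
      ∑ p ∈ range N, c p * (x ^ p - y ^ p) +
        ∑ q ∈ range N, c (N + q) * (x ^ N * y ^ q - y ^ N * x ^ q) := by
  have hx : x * ∑ p ∈ range N, ∑ q ∈ range N, c (p + q + 1) * x ^ p * y ^ q =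
      ∑ q ∈ range N, ∑ p ∈ range N, c (p + q) * x ^ p * y ^ q +
        ∑ q ∈ range N, (c (N + q) * x ^ N * y ^ q - c q * y ^ q) := by
    rw [sum_comm, mul_sum, ← sum_add_distrib]
    refine sum_congr rfl fun q _ => ?_
    have h := sum_range_sub (fun p => c (p + q) * x ^ p * y ^ q) N
    rw [sum_sub_distrib, sub_eq_iff_eq_add] at h
    have h' : x * ∑ p ∈ range N, c (p + q + 1) * x ^ p * y ^ q =
        ∑ p ∈ range N, c (p + 1 + q) * x ^ (p + 1) * y ^ q := by
      rw [mul_sum]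
      refine sum_congr rfl fun p _ => ?_
      rw [add_right_comm p 1 q]
      ring
    rw [h', h, zero_add, pow_zero]
    ring
  have hy : y * ∑ p ∈ range N, ∑ q ∈ range N, c (p + q + 1) * x ^ p * y ^ q =
      ∑ q ∈ range N, ∑ p ∈ range N, c (p + q) * x ^ p * y ^ q +
        ∑ p ∈ range N, (c (N + p) * y ^ N * x ^ p - c p * x ^ p) := by
    rw [sum_comm (s := range N) (t := range N) (f := fun q p => c (p + q) * x ^ p * y ^ q),
      mul_sum, ← sum_add_distrib]
    refine sum_congr rfl fun p _ => ?_
    have h := sum_range_sub (fun q => c (p + q) * x ^ p * y ^ q) N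
    rw [sum_sub_distrib, sub_eq_iff_eq_add] at h
    have h' : y * ∑ q ∈ range N, c (p + q + 1) * x ^ p * y ^ q =
        ∑ q ∈ range N, c (p + (q + 1)) * x ^ p * y ^ (q + 1) := by
      rw [mul_sum]
      refine sum_congr rfl fun q _ => ?_
      rw [← add_assoc p q 1]
      ring
    rw [h', h, add_zero, pow_zero, add_comm p N]
    ring
  rw [sub_mul, hx, hy, add_sub_add_left_eq_sub, ← sum_sub_distrib, ← sum_add_distrib]
  exact sum_congr rfl fun q _ => by ring

/-- Lemma 6.3 of the paper: in any commutative ring,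
`(x − y) · Σ_{p,q ≥ 0} C(2ℓ+1, p+q+1) x^p y^q = (x+1)^{2ℓ+1} − (y+1)^{2ℓ+1}`,
where the (finitely supported) double sum equals the sum over `0 ≤ p, q ≤ 2ℓ`. -/
theorem stmt4 (R : Type*) [CommRing R] (ℓ : ℕ) (x y : R) :
    (x - y) *
        ∑ p ∈ range (2 * ℓ + 1), ∑ q ∈ range (2 * ℓ + 1),
          ((2 * ℓ + 1).choose (p + q + 1) : R) * x ^ p * y ^ q =
      (x + 1) ^ (2 * ℓ + 1) - (y + 1) ^ (2 * ℓ + 1) := by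
  rw [sub_mul_sum_range_sum_range (fun k => ((2 * ℓ + 1).choose k : R)), add_pow, add_pow,
    sum_range_succ _ (2 * ℓ + 1), sum_range_succ _ (2 * ℓ + 1), add_sub_add_comm,
    ← sum_sub_distrib]
  congr 1
  · exact sum_congr rfl fun p _ => by rw [one_pow]; ring
  · rw [sum_eq_single_of_mem 0 (mem_range.2 (Nat.succ_pos _))]
    · simp
    · intro q _ hq
      rw [Nat.choose_eq_zero_of_lt (by omega), Nat.cast_zero, zero_mul]
end

section
/- For every natural number ℓ and every element t of a commutative ring, Σ_{p,q ≥ 0, p+q ≤ 2ℓ} C(2ℓ+1, p+q+1) · t^{2ℓ−p−q} · Σ_{i=0}^{p} Σ_{j=0}^{q} C(p, i) · C(q, j) · C(2ℓ−p−q, ℓ−q−i+j) · t^{2i+2j} = Σ_{a=0}^{ℓ} C(2a, a) · t^a · (t+1)^{4ℓ−2a}. Here the inner binomial coefficient C(2ℓ−p−q, ℓ−q−i+j) is interpreted as 0 when the integer ℓ−q−i+j is negative or exceeds 2ℓ−p−q. -/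
open Finset

section

open Polynomial

variable {R : Type*} [CommRing R]

/-- Pascal's rule for the truncated expansion of `(1 + t) ^ n`. -/
theorem sum_range_succ_choose_mul_pow (t : R) (n m : ℕ) :
    ∑ k ∈ range (m + 1), ((n + 1).choose k : R) * t ^ k =
      (1 + t) * ∑ k ∈ range (m + 1), (n.choose k : R) * t ^ k - (n.choose m : R) * t ^ (m + 1) := by
  induction m with
  | zero => simp
  | succ m ih =>
    rw [sum_range_succ, ih, sum_range_succ _ (m + 1), Nat.choose_succ_succ]
    push_cast
    ring

/-- Pascal's rule for the truncated expansion of `(t + 1) ^ n` in descending powers of `t`. -/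
theorem sum_range_succ_choose_mul_pow_sub (t : R) (n m : ℕ) (h : m ≤ n) :
    ∑ k ∈ range (m + 1), ((n + 1).choose k : R) * t ^ (n + 1 - k) =
      (1 + t) * ∑ k ∈ range (m + 1), (n.choose k : R) * t ^ (n - k) -
        (n.choose m : R) * t ^ (n - m) := by
  induction m with
  | zero => simp [pow_succ]; ring
  | succ m ih =>
    obtain ⟨d, rfl⟩ := Nat.exists_eq_add_of_le h
    rw [sum_range_succ, ih (by omega), sum_range_succ _ (m + 1), Nat.choose_succ_succ]
    have h1 : m + 1 + d + 1 - (m + 1) = d + 1 := by omega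
    have h2 : m + 1 + d - (m + 1) = d := by omega
    have h3 : m + 1 + d - m = d + 1 := by omega
    rw [h1, h2, h3]
    push_cast
    ring

theorem sum_choose_mul_pow_sub_pow (t : R) (l : ℕ) :
    ∑ k ∈ range (l + 1), ((2 * l + 1).choose k : R) * (t ^ k - t ^ (2 * l + 1 - k)) =
      (1 - t) * ∑ a ∈ range (l + 1), ((2 * a).choose a : R) * t ^ a * (t + 1) ^ (2 * l - 2 * a) := by
  induction l with
  | zero => simp
  | succ l ih =>
    have hc : (2 * l + 1).choose (l + 1) = (2 * l + 1).choose l :=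
      Nat.choose_symm_half l
    have hc2 : (2 * l + 2).choose (l + 1) = 2 * (2 * l + 1).choose l := by
      rw [Nat.choose_succ_succ, hc]; ring
    have hr : ∑ a ∈ range (l + 1),
          ((2 * a).choose a : R) * t ^ a * (t + 1) ^ (2 * (l + 1) - 2 * a) =
        (t + 1) ^ 2 * ∑ a ∈ range (l + 1),
          ((2 * a).choose a : R) * t ^ a * (t + 1) ^ (2 * l - 2 * a) := by
      rw [mul_sum]
      refine sum_congr rfl fun a ha => ?_
      rw [show 2 * (l + 1) - 2 * a = 2 * l - 2 * a + 2 by have := mem_range.1 ha; omega, pow_add]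
      ring
    rw [sum_range_succ (fun a => ((2 * a).choose a : R) * t ^ a * (t + 1) ^ (2 * (l + 1) - 2 * a)),
      hr, mul_add (1 - t), mul_left_comm (1 - t), ← ih]
    simp only [mul_sub, sum_sub_distrib, show 2 * (l + 1) + 1 = 2 * l + 2 + 1 by ring]
    rw [sum_range_succ_choose_mul_pow, sum_range_succ_choose_mul_pow_sub _ _ _ (by omega),
      sum_range_succ_choose_mul_pow, sum_range_succ_choose_mul_pow_sub _ _ _ (by omega),
      sum_range_succ _ (l + 1), sum_range_succ _ (l + 1), hc, hc2,
      show 2 * (l + 1) = 2 * l + 2 by ring, hc2,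
      show 2 * l + 1 - (l + 1) = l by omega, show 2 * l + 2 - (l + 1) = l + 1 by omega,
      Nat.sub_self]
    push_cast
    ring

theorem coeff_eq_sum_coeff_mul_one_sub_X (P : R[X]) (l : ℕ) :
    P.coeff l = ∑ k ∈ range (l + 1), (P * (1 - X)).coeff k := by
  induction l with
  | zero => simp [mul_sub]
  | succ l ih => rw [sum_range_succ, ← ih, mul_sub, coeff_sub, coeff_mul_X]; simp

theorem coeff_one_add_C_mul_X_pow (t : R) (n k : ℕ) :
    ((1 + C t * X) ^ n).coeff k = (n.choose k : R) * t ^ k := by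
  have h : (1 + C t * X : R[X]) ^ n = ((1 + X) ^ n).comp (C t * X) := by simp
  rw [h, comp_C_mul_X_coeff, coeff_one_add_X_pow]

theorem coeff_one_add_X_pow_mul_mul (u : R) (m p q l : ℕ) :
    ((1 + X) ^ m * (1 + C u * X) ^ p * (X + C u) ^ q : R[X]).coeff l =
      ∑ i ∈ range (p + 1), ∑ j ∈ range (q + 1), (p.choose i : R) * (q.choose j : R) *
        (if q + i ≤ l + j then (m.choose (l + j - (q + i)) : R) else 0) * u ^ (i + j) := by
  have hexp : ((1 + X) ^ m * (1 + C u * X) ^ p * (X + C u) ^ q : R[X]) =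
      ∑ i ∈ range (p + 1), ∑ j ∈ range (q + 1),
        C ((p.choose i : R) * (q.choose j : R) * u ^ (i + j)) *
          (X ^ (i + (q - j)) * (1 + X) ^ m) := by
    rw [add_comm 1 (C u * X), add_comm X (C u), add_pow (C u * X), add_pow (C u), mul_assoc,
      sum_mul_sum, mul_sum]
    refine sum_congr rfl fun i _ => ?_
    rw [mul_sum]
    refine sum_congr rfl fun j _ => ?_
    simp only [map_mul, map_pow, map_natCast, one_pow]
    ring
  rw [hexp, finsetSum_coeff]
  refine sum_congr rfl fun i _ => ?_
  rw [finsetSum_coeff]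
  refine sum_congr rfl fun j hj => ?_
  have hj' : j ≤ q := by have := mem_range.1 hj; omega
  rw [coeff_C_mul, coeff_X_pow_mul', coeff_one_add_X_pow,
    show l - (i + (q - j)) = l + j - (q + i) by omega]
  simp only [show i + (q - j) ≤ l ↔ q + i ≤ l + j by omega]
  ring

/-- The divided difference of `x ↦ (x + c) ^ n` at `a` and `b`, expanded in powers of `a`, `b`
and `c`. -/
theorem sum_choose_mul_pow_mul_sub (a b c : R) (n : ℕ) :
    (∑ p ∈ range n, ∑ q ∈ range (n - p),
      (n.choose (p + q + 1) : R) * c ^ (n - 1 - p - q) * (a ^ p * b ^ q)) * (a - b) =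
      (a + c) ^ n - (b + c) ^ n := by
  rw [← sum_range_diag_flip n fun p q =>
    (n.choose (p + q + 1) : R) * c ^ (n - 1 - p - q) * (a ^ p * b ^ q), sum_mul, add_pow, add_pow,
    sum_range_succ', sum_range_succ' (n := n), add_sub_add_comm, ← sum_sub_distrib]
  simp only [pow_zero, sub_self, add_zero]
  refine sum_congr rfl fun s _ => ?_
  have h : ∀ i ∈ range (s + 1),
      (n.choose (i + (s - i) + 1) : R) * c ^ (n - 1 - i - (s - i)) * (a ^ i * b ^ (s - i)) =
        (n.choose (s + 1) : R) * c ^ (n - (s + 1)) * (a ^ i * b ^ (s + 1 - 1 - i)) := by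
    intro i hi
    have := mem_range.1 hi
    rw [show i + (s - i) = s by omega, show n - 1 - i - (s - i) = n - (s + 1) by omega,
      Nat.add_sub_cancel]
  rw [sum_congr rfl h, ← mul_sum, mul_assoc, geom_sum₂_mul]
  ring

theorem sum_choose_mul_sum_choose_of_isDomain [IsDomain R] (t : R) (h1 : 1 - t ≠ 0)
    (h2 : t + 1 ≠ 0) (l : ℕ) :
    ∑ p ∈ range (2 * l + 1), ∑ q ∈ range (2 * l + 1 - p),
        ((2 * l + 1).choose (p + q + 1) : R) * t ^ (2 * l - p - q) *
          ∑ i ∈ range (p + 1), ∑ j ∈ range (q + 1),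
            (p.choose i : R) * (q.choose j : R) *
              (if q + i ≤ l + j then ((2 * l - p - q).choose (l + j - (q + i)) : R) else 0) *
              t ^ (2 * i + 2 * j) =
      ∑ a ∈ range (l + 1), ((2 * a).choose a : R) * t ^ a * (t + 1) ^ (4 * l - 2 * a) := by
  set G : R[X] := ∑ p ∈ range (2 * l + 1), ∑ q ∈ range (2 * l + 1 - p),
    ((2 * l + 1).choose (p + q + 1) : R[X]) * (C t * (1 + X)) ^ (2 * l + 1 - 1 - p - q) *
      ((1 + C (t ^ 2) * X) ^ p * (X + C (t ^ 2)) ^ q) with hG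
  have hG1 : G * (1 - X) * C (1 - t) =
      C ((t + 1) ^ (2 * l)) * ((1 + C t * X) ^ (2 * l + 1) - (X + C t) ^ (2 * l + 1)) := by
    have hC : (C (t + 1) : R[X]) ≠ 0 := C_ne_zero.2 h2
    refine mul_right_cancel₀ hC ?_
    have key := sum_choose_mul_pow_mul_sub (1 + C (t ^ 2) * X : R[X]) (X + C (t ^ 2))
      (C t * (1 + X)) (2 * l + 1)
    rw [← hG, show (1 + C (t ^ 2) * X + C t * (1 + X) : R[X]) = C (t + 1) * (1 + C t * X) by
        simp only [map_pow, map_add, map_one]; ring,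
      show (X + C (t ^ 2) + C t * (1 + X) : R[X]) = C (t + 1) * (X + C t) by
        simp only [map_pow, map_add, map_one]; ring, mul_pow, mul_pow] at key
    calc G * (1 - X) * C (1 - t) * C (t + 1)
        = G * (1 + C (t ^ 2) * X - (X + C (t ^ 2))) := by
          simp only [map_pow, map_add, map_sub, map_one]; ring
      _ = _ := by rw [key, map_pow]; ring
  have hcoeff : G.coeff l = ∑ p ∈ range (2 * l + 1), ∑ q ∈ range (2 * l + 1 - p),
        ((2 * l + 1).choose (p + q + 1) : R) * t ^ (2 * l - p - q) *
          ∑ i ∈ range (p + 1), ∑ j ∈ range (q + 1),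
            (p.choose i : R) * (q.choose j : R) *
              (if q + i ≤ l + j then ((2 * l - p - q).choose (l + j - (q + i)) : R) else 0) *
              t ^ (2 * i + 2 * j) := by
    rw [hG, finsetSum_coeff]
    refine sum_congr rfl fun p _ => ?_
    rw [finsetSum_coeff]
    refine sum_congr rfl fun q _ => ?_
    have h := coeff_one_add_X_pow_mul_mul (t ^ 2) (2 * l - p - q) p q l
    simp only [← pow_mul, mul_add] at h
    rw [← h, ← coeff_C_mul, Nat.add_sub_cancel]
    congr 1
    simp only [map_mul, map_pow, map_natCast, mul_pow]
    ring
  rw [← hcoeff]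
  refine mul_right_cancel₀ h1 ?_
  rw [← coeff_mul_C, coeff_eq_sum_coeff_mul_one_sub_X, mul_right_comm, hG1]
  have hsum : ∀ k ∈ range (l + 1),
      (C ((t + 1) ^ (2 * l)) * ((1 + C t * X) ^ (2 * l + 1) - (X + C t) ^ (2 * l + 1))).coeff k =
        (t + 1) ^ (2 * l) * (((2 * l + 1).choose k : R) * (t ^ k - t ^ (2 * l + 1 - k))) := by
    intro k _
    rw [coeff_C_mul, coeff_sub, coeff_one_add_C_mul_X_pow, coeff_X_add_C_pow]
    ring
  rw [sum_congr rfl hsum, ← mul_sum, sum_choose_mul_pow_sub_pow, mul_left_comm, mul_comm, mul_sum]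
  congr 1
  refine sum_congr rfl fun a ha => ?_
  rw [show 4 * l - 2 * a = 2 * l + (2 * l - 2 * a) by have := mem_range.1 ha; omega, pow_add]
  ring

end

/-- Theorem 6.4 of the paper: for every natural number `ℓ` and element `t` of a
commutative ring,
`Σ_{p+q ≤ 2ℓ} C(2ℓ+1,p+q+1) t^{2ℓ−p−q} Σ_{i=0}^{p} Σ_{j=0}^{q}
   C(p,i) C(q,j) C(2ℓ−p−q, ℓ−q−i+j) t^{2i+2j}
 = Σ_{a=0}^{ℓ} C(2a,a) t^a (t+1)^{4ℓ−2a}`,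
where `C(2ℓ−p−q, ℓ−q−i+j)` is `0` when the integer `ℓ−q−i+j` is negative. -/
theorem stmt5 (R : Type*) [CommRing R] (ℓ : ℕ) (t : R) :
    ∑ p ∈ range (2 * ℓ + 1), ∑ q ∈ range (2 * ℓ + 1 - p),
        ((2 * ℓ + 1).choose (p + q + 1) : R) * t ^ (2 * ℓ - p - q) *
          ∑ i ∈ range (p + 1), ∑ j ∈ range (q + 1),
            (p.choose i : R) * (q.choose j : R) *
              (if q + i ≤ ℓ + j then ((2 * ℓ - p - q).choose (ℓ + j - (q + i)) : R) else 0) *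
              t ^ (2 * i + 2 * j) =
      ∑ a ∈ range (ℓ + 1), ((2 * a).choose a : R) * t ^ a * (t + 1) ^ (4 * ℓ - 2 * a) := by
  have h1 : (1 - Polynomial.X : Polynomial ℤ) ≠ 0 := fun h => by
    simpa using congrArg (Polynomial.eval 0) h
  have h2 : (Polynomial.X + 1 : Polynomial ℤ) ≠ 0 := fun h => by
    simpa using congrArg (Polynomial.eval 0) h
  have h := congrArg (Polynomial.aeval t) (sum_choose_mul_sum_choose_of_isDomain _ h1 h2 ℓ)
  simpa [apply_ite (Polynomial.aeval t)] using h
end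

section
/- For every natural number n, Σ_{ℓ=0}^{⌊n/2⌋} (2ℓ+1) · (C(n, 2ℓ) + 2·C(n, 2ℓ+1)) · C(2ℓ, ℓ) = Σ_{k=0}^{n} (k+1) · C(n, k) · C(k, ⌊k/2⌋). (Multiplying both sides by 2^n, the left side is the normalized volume of the symmetric edge polytope Σ(Γ(n+1)) obtained by evaluating its h*-polynomial at t = 1, and the right side is the closed form 2^n Σ_k (k+1) C(n,k) C(k, ⌊k/2⌋).) -/
open Finset

theorem sum_range_two_mul_eq_sum_pairs (f : ℕ → ℕ) (m : ℕ) :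
    ∑ k ∈ range (2 * m), f k = ∑ l ∈ range m, (f (2 * l) + f (2 * l + 1)) := by
  induction m with
  | zero => simp
  | succ m ih =>
    rw [sum_range_succ, ← ih, Nat.mul_succ, sum_range_succ, sum_range_succ, add_assoc]

theorem succ_mul_choose_two_mul_add_one (l : ℕ) :
    (l + 1) * (2 * l + 1).choose l = (2 * l + 1) * (2 * l).choose l := by
  rw [Nat.add_one_mul_choose_eq, Nat.choose_symm_half, mul_comm]

/-- Corollary 4.7 of the paper (with the common factor `2^n` cleared):
`Σ_{ℓ=0}^{⌊n/2⌋} (2ℓ+1)(C(n,2ℓ) + 2 C(n,2ℓ+1)) C(2ℓ,ℓ)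
 = Σ_{k=0}^{n} (k+1) C(n,k) C(k,⌊k/2⌋)`. -/
theorem stmt7 (n : ℕ) :
    ∑ ℓ ∈ range (n / 2 + 1),
        (2 * ℓ + 1) * (n.choose (2 * ℓ) + 2 * n.choose (2 * ℓ + 1)) * (2 * ℓ).choose ℓ =
      ∑ k ∈ range (n + 1), (k + 1) * n.choose k * k.choose (k / 2) := by
  have extend : ∑ k ∈ range (n + 1), (k + 1) * n.choose k * k.choose (k / 2) =
      ∑ k ∈ range (2 * (n / 2 + 1)), (k + 1) * n.choose k * k.choose (k / 2) := by
    refine sum_subset (range_mono (by omega)) fun k _ hk => ?_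
    rw [Nat.choose_eq_zero_of_lt (by simpa using hk)]
    simp
  rw [extend, sum_range_two_mul_eq_sum_pairs]
  refine sum_congr rfl fun l _ => ?_
  rw [show 2 * l / 2 = l by omega, show (2 * l + 1) / 2 = l by omega]
  linear_combination 2 * n.choose (2 * l + 1) * (succ_mul_choose_two_mul_add_one l).symm
end

section
/- Let t and λ be real numbers with t ≥ 0, λ ≥ 0, and (t+1)^4 · λ < 1. Then the series Σ_{ℓ ≥ 0} F_ℓ(t) · λ^ℓ, where F_ℓ(t) = Σ_{a=0}^{ℓ} C(2a, a) · t^a · (t+1)^{4ℓ−2a}, converges with sum 1 / ((1 − (t+1)^4 λ) · √(1 − 4t(t+1)^2 λ)). (Note that 4t(t+1)^2 ≤ (t+1)^4 for t ≥ 0, so 1 − 4t(t+1)^2 λ > 0 and the square root is well defined.) -/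
open Finset

/-- The normalized central binomial coefficients are the binomial coefficients of `(1 - x)^(-1/2)`. -/
lemma ring_choose_half_eq_centralBinom_div (n : ℕ) :
    Ring.choose ((1 / 2 : ℝ) + n - 1) n = (n.centralBinom : ℝ) / 4 ^ n := by
  have key : ∀ n : ℕ, (ascPochhammer ℝ n).eval (1 / 2 : ℝ) =
      (n.factorial : ℝ) * ((n.centralBinom : ℝ) / 4 ^ n) := by
    intro n
    induction n with
    | zero => simp
    | succ k ih =>
      have hc : ((k : ℝ) + 1) * ((k + 1).centralBinom : ℝ) =
          2 * (2 * k + 1) * (k.centralBinom : ℝ) := by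
        exact_mod_cast Nat.succ_mul_centralBinom_succ k
      rw [ascPochhammer_succ_eval, ih, Nat.factorial_succ, pow_succ]
      push_cast
      field_simp
      linear_combination (-2 : ℝ) * hc
  have hfac := Ring.factorial_nsmul_multichoose_eq_ascPochhammer (1 / 2 : ℝ) n
  rw [Polynomial.ascPochhammer_smeval_eq_eval, key, nsmul_eq_mul] at hfac
  have hn : (n.factorial : ℝ) ≠ 0 := by positivity
  rw [Ring.choose, show (1 / 2 : ℝ) + n - 1 - n + 1 = 1 / 2 by ring]
  exact mul_left_cancel₀ hn hfac

/-- The generating function of the central binomial coefficients. -/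
lemma hasSum_centralBinom_mul_pow {x : ℝ} (hx : |4 * x| < 1) :
    HasSum (fun n : ℕ => (n.centralBinom : ℝ) * x ^ n) (1 / Real.sqrt (1 - 4 * x)) := by
  have hmem : 4 * x ∈ Metric.eball (0 : ℝ) 1 := by
    rw [← ENNReal.ofReal_one, Metric.eball_ofReal, mem_ball_zero_iff]
    exact hx
  have hs := (Real.one_div_one_sub_rpow_hasFPowerSeriesOnBall_zero (1 / 2)).hasSum hmem
  rw [zero_add, ← Real.sqrt_eq_rpow] at hs
  refine hs.congr_fun fun n => ?_
  rw [FormalMultilinearSeries.ofScalars_apply_eq, ring_choose_half_eq_centralBinom_div,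
    smul_eq_mul, mul_pow]
  field_simp

/-- The generating-function identity for `F_ℓ` from the proof of Theorem 6.4:
for `t ≥ 0`, `λ ≥ 0` with `(t+1)^4 λ < 1`, the series `Σ_ℓ F_ℓ(t) λ^ℓ`, where
`F_ℓ(t) = Σ_{a=0}^{ℓ} C(2a,a) t^a (t+1)^{4ℓ−2a}`, has sum
`1 / ((1 − (t+1)^4 λ) √(1 − 4t(t+1)^2 λ))`. -/
theorem stmt8 (t lam : ℝ) (ht : 0 ≤ t) (hlam : 0 ≤ lam)
    (h : (t + 1) ^ 4 * lam < 1) :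
    HasSum
      (fun ℓ : ℕ =>
        (∑ a ∈ range (ℓ + 1), ((2 * a).choose a : ℝ) * t ^ a * (t + 1) ^ (4 * ℓ - 2 * a)) *
          lam ^ ℓ)
      (1 / ((1 - (t + 1) ^ 4 * lam) * Real.sqrt (1 - 4 * t * (t + 1) ^ 2 * lam))) := by
  have hb : 0 ≤ (t + 1) ^ 4 * lam := by positivity
  have hub : 4 * (t * (t + 1) ^ 2 * lam) ≤ (t + 1) ^ 4 * lam := by
    have : 0 ≤ (t + 1) ^ 2 * (t - 1) ^ 2 * lam := by positivity
    linear_combination this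
  have hf := hasSum_centralBinom_mul_pow (x := t * (t + 1) ^ 2 * lam)
    (by rw [abs_of_nonneg (by positivity)]; linarith)
  have hg := hasSum_geometric_of_lt_one hb h
  have hfg := hasSum_sum_range_mul_of_summable_norm hf.summable.norm hg.summable.norm
  rw [hf.tsum_eq, hg.tsum_eq] at hfg
  rw [show 1 / ((1 - (t + 1) ^ 4 * lam) * Real.sqrt (1 - 4 * t * (t + 1) ^ 2 * lam)) =
      1 / Real.sqrt (1 - 4 * (t * (t + 1) ^ 2 * lam)) * (1 - (t + 1) ^ 4 * lam)⁻¹ by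
    rw [show 4 * (t * (t + 1) ^ 2 * lam) = 4 * t * (t + 1) ^ 2 * lam by ring,
      one_div, one_div, mul_inv, mul_comm]]
  refine hfg.congr_fun fun l => ?_
  rw [sum_mul]
  refine sum_congr rfl fun a ha => ?_
  obtain ⟨b, rfl⟩ := Nat.exists_eq_add_of_le (Nat.lt_succ_iff.mp (mem_range.mp ha))
  rw [show 4 * (a + b) - 2 * a = 2 * a + 4 * b by omega, Nat.add_sub_cancel_left,
    Nat.centralBinom_eq_two_mul_choose, pow_add, pow_mul, pow_mul]
  simp only [mul_pow]
  ring
end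

section
/- For every natural number ℓ and every real number t, 4^ℓ · Σ_{a=0}^{ℓ} C(2a, a) · t^a · (1+t)^{4ℓ−2a} = Σ_{k=0}^{ℓ} (−1)^k · ((2ℓ+1)/(2k+1)) · C(ℓ, k) · C(2ℓ, ℓ) · (1−t)^{2k} · (1+t)^{4ℓ−2k}. (This identity combines the closed form for G_{ℓ,ℓ} obtained via Lemma 6.1 with the identity G_{ℓ,ℓ} = F_ℓ of Theorem 6.4.) -/
open Finset

/-- Recursion for `∫₀¹ (s - u x²) ^ n dx`, written out as a binomial sum. -/
theorem sum_choose_div_odd_succ (n : ℕ) (s u : ℝ) :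
    (2 * n + 3 : ℝ) * ∑ k ∈ range (n + 2),
        ((n + 1).choose k : ℝ) / (2 * k + 1) * (-u) ^ k * s ^ (n + 1 - k) =
      (s - u) ^ (n + 1) + 2 * (n + 1) * s * ∑ k ∈ range (n + 1),
        (n.choose k : ℝ) / (2 * k + 1) * (-u) ^ k * s ^ (n - k) := by
  have hext : s * ∑ k ∈ range (n + 1), (n.choose k : ℝ) / (2 * k + 1) * (-u) ^ k * s ^ (n - k) =
      ∑ k ∈ range (n + 2), (n.choose k : ℝ) / (2 * k + 1) * (-u) ^ k * s ^ (n + 1 - k) := by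
    rw [sum_range_succ _ (n + 1), Nat.choose_succ_self, mul_sum]
    simp only [Nat.cast_zero, zero_div, zero_mul, add_zero]
    refine sum_congr rfl fun k hk => ?_
    rw [Nat.succ_sub (mem_range_succ_iff.mp hk), pow_succ]
    ring
  rw [mul_assoc _ s, hext, sub_eq_neg_add, add_pow, mul_sum, mul_sum, ← sum_add_distrib]
  refine sum_congr rfl fun k hk => ?_
  have hchoose : (n.choose k : ℝ) * (n + 1) = (n + 1).choose k * (n + 1 - k) := by
    have h := Nat.choose_mul_succ_eq n k
    rw [← Nat.cast_inj (R := ℝ)] at h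
    push_cast [Nat.cast_sub (mem_range_succ_iff.mp hk)] at h
    exact h
  have hk0 : (2 * k + 1 : ℝ) ≠ 0 := by positivity
  field_simp
  linear_combination (-2 : ℝ) * (-u) ^ k * s ^ (n + 1 - k) * hchoose

theorem four_pow_mul_sum_centralBinom (n : ℕ) (s t : ℝ) :
    (4 : ℝ) ^ n * ∑ a ∈ range (n + 1), (a.centralBinom : ℝ) * t ^ a * s ^ (n - a) =
      (2 * n + 1) * n.centralBinom * ∑ k ∈ range (n + 1),
        (n.choose k : ℝ) / (2 * k + 1) * (-(s - 4 * t)) ^ k * s ^ (n - k) := by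
  induction n with
  | zero => simp
  | succ n ih =>
    have hleft : ∑ a ∈ range (n + 1), (a.centralBinom : ℝ) * t ^ a * s ^ (n + 1 - a) =
        s * ∑ a ∈ range (n + 1), (a.centralBinom : ℝ) * t ^ a * s ^ (n - a) := by
      rw [mul_sum]
      refine sum_congr rfl fun a ha => ?_
      rw [Nat.succ_sub (mem_range_succ_iff.mp ha), pow_succ]
      ring
    have hrec := sum_choose_div_odd_succ n s (s - 4 * t)
    rw [sub_sub_cancel, mul_pow] at hrec
    have hcentral : ((n + 1 : ℝ)) * (n + 1).centralBinom = 2 * (2 * n + 1) * n.centralBinom := by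
      exact_mod_cast Nat.succ_mul_centralBinom_succ n
    rw [sum_range_succ, hleft, Nat.sub_self, pow_zero]
    push_cast
    generalize ∑ k ∈ range (n + 1 + 1),
      ((n + 1).choose k : ℝ) / (2 * k + 1) * (-(s - 4 * t)) ^ k * s ^ (n + 1 - k) = S' at hrec ⊢
    generalize ∑ k ∈ range (n + 1),
      (n.choose k : ℝ) / (2 * k + 1) * (-(s - 4 * t)) ^ k * s ^ (n - k) = S at hrec ih
    linear_combination 4 * s * ih - ((n + 1).centralBinom : ℝ) * hrec - 2 * s * S * hcentral

/-- The identity `4^ℓ F_ℓ(t) = 4^ℓ G_{ℓ,ℓ}(t)` from the proof of Theorem 6.4: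
for every natural number `ℓ` and real `t`,
`4^ℓ Σ_{a=0}^{ℓ} C(2a,a) t^a (1+t)^{4ℓ−2a}
 = Σ_{k=0}^{ℓ} (−1)^k ((2ℓ+1)/(2k+1)) C(ℓ,k) C(2ℓ,ℓ) (1−t)^{2k} (1+t)^{4ℓ−2k}`. -/
theorem stmt10 (ℓ : ℕ) (t : ℝ) :
    (4 : ℝ) ^ ℓ *
        ∑ a ∈ range (ℓ + 1), ((2 * a).choose a : ℝ) * t ^ a * (1 + t) ^ (4 * ℓ - 2 * a) =
      ∑ k ∈ range (ℓ + 1),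
        (-1 : ℝ) ^ k * ((2 * ℓ + 1 : ℝ) / (2 * k + 1)) * (ℓ.choose k : ℝ) *
          ((2 * ℓ).choose ℓ : ℝ) * (1 - t) ^ (2 * k) * (1 + t) ^ (4 * ℓ - 2 * k) := by
  have hpow : ∀ a ∈ range (ℓ + 1),
      (1 + t) ^ (4 * ℓ - 2 * a) = ((1 + t) ^ 2) ^ ℓ * ((1 + t) ^ 2) ^ (ℓ - a) := by
    intro a ha
    have := mem_range_succ_iff.mp ha
    rw [← pow_add, ← pow_mul]
    congr 1
    omega
  have key := congrArg (((1 + t) ^ 2) ^ ℓ * ·) (four_pow_mul_sum_centralBinom ℓ ((1 + t) ^ 2) t)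
  rw [show (1 + t) ^ 2 - 4 * t = (1 - t) ^ 2 by ring] at key
  simp only [mul_sum, Nat.centralBinom_eq_two_mul_choose] at key ⊢
  convert key using 1
  · refine sum_congr rfl fun a ha => ?_
    rw [hpow a ha]
    ring
  · refine sum_congr rfl fun k hk => ?_
    rw [hpow k hk, neg_pow ((1 - t) ^ 2), pow_mul (1 - t)]
    ring
end

section
/- Let G be a connected simple graph on the vertex set {1, …, n} with n ≥ 1, and let Σ(G) = conv{ ±(e_i − e_j) : ij an edge of G } ⊆ ℝ^n be its symmetric edge polytope, where e_1, …, e_n are the standard basis vectors of ℝ^n. Then the dimension of Σ(G) equals n − 1; that is, the vector span of the differences of points of Σ(G) (equivalently, the direction of its affine span) is an (n−1)-dimensional subspace of ℝ^n. -/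
/-- The edge vectors `e_i - e_j` of a graph `G`, in both orientations. -/
def edgeVectors {V : Type*} [DecidableEq V] (G : SimpleGraph V) : Set (V → ℝ) :=
  {v | ∃ i j : V, G.Adj i j ∧ v = Pi.single i (1 : ℝ) - Pi.single j (1 : ℝ)}

lemma vectorSpan_convexHull_eq {E : Type*} [AddCommGroup E] [Module ℝ E] (s : Set E) :
    vectorSpan ℝ (convexHull ℝ s) = vectorSpan ℝ s := by
  rw [← direction_affineSpan, affineSpan_convexHull, direction_affineSpan]

lemma single_sub_single_mem_vectorSpan_of_adj {V : Type*} [DecidableEq V] {G : SimpleGraph V}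
    {i j : V} (h : G.Adj i j) :
    Pi.single i (1 : ℝ) - Pi.single j (1 : ℝ) ∈ vectorSpan ℝ (edgeVectors G) := by
  have hmem := vsub_mem_vectorSpan ℝ (s := edgeVectors G) ⟨i, j, h, rfl⟩ ⟨j, i, h.symm, rfl⟩
  convert Submodule.smul_mem _ (1 / 2 : ℝ) hmem using 1
  rw [vsub_eq_sub]
  module

lemma single_sub_single_mem_vectorSpan_of_reachable {V : Type*} [DecidableEq V]
    {G : SimpleGraph V} {i j : V} (h : G.Reachable i j) :
    Pi.single i (1 : ℝ) - Pi.single j (1 : ℝ) ∈ vectorSpan ℝ (edgeVectors G) := by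
  obtain ⟨p⟩ := h
  induction p with
  | nil => simp
  | cons hadj _ ih =>
    simpa using add_mem (single_sub_single_mem_vectorSpan_of_adj hadj) ih

/-- For a connected graph, the edge vectors span the hyperplane of vectors with coordinate
sum zero. -/
lemma vectorSpan_edgeVectors {V : Type*} [Fintype V] [DecidableEq V] {G : SimpleGraph V}
    (hG : G.Connected) :
    vectorSpan ℝ (edgeVectors G) =
      LinearMap.ker (∑ i, LinearMap.proj i : (V → ℝ) →ₗ[ℝ] ℝ) := by
  apply le_antisymm
  · rw [vectorSpan_def, Submodule.span_le]
    rintro _ ⟨_, ⟨i, j, -, rfl⟩, _, ⟨k, l, -, rfl⟩, rfl⟩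
    simp
  · intro x hx
    obtain ⟨v⟩ := hG.nonempty
    have hsum : ∑ i, x i = 0 := by simpa using hx
    have hrepr : x = ∑ i, x i • (Pi.single i (1 : ℝ) - Pi.single v (1 : ℝ) : V → ℝ) := by
      simp only [smul_sub, Finset.sum_sub_distrib, ← Finset.sum_smul, hsum, zero_smul, sub_zero]
      exact pi_eq_sum_univ' x
    rw [hrepr]
    exact Submodule.sum_mem _ fun i _ => Submodule.smul_mem _ _
      (single_sub_single_mem_vectorSpan_of_reachable (hG.preconnected i v))


/-- Proposition 3.1 of the paper, for graphs: if `G` is a connected simple graph on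
`n ≥ 1` vertices, then the symmetric edge polytope
`Σ(G) = conv{±(e_i − e_j) : ij ∈ E(G)} ⊆ ℝ^n` has dimension `n − 1`, i.e. the
vector span of (differences of points of) `Σ(G)` has rank `n − 1`. -/
theorem stmt11 (n : ℕ) (hn : 1 ≤ n) (G : SimpleGraph (Fin n)) (hG : G.Connected) :
    Module.finrank ℝ
        (vectorSpan ℝ (convexHull ℝ
          {v : Fin n → ℝ | ∃ i j : Fin n, G.Adj i j ∧
            v = Pi.single i (1 : ℝ) - Pi.single j (1 : ℝ)})) = n - 1 := by
  change Module.finrank ℝ (vectorSpan ℝ (convexHull ℝ (edgeVectors G))) = n - 1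
  rw [vectorSpan_convexHull_eq, vectorSpan_edgeVectors hG]
  have hne : (∑ i, LinearMap.proj i : (Fin n → ℝ) →ₗ[ℝ] ℝ) ≠ 0 := by
    intro h
    have := LinearMap.congr_fun h (Pi.single (⟨0, hn⟩ : Fin n) 1)
    simp at this
  have hker := Module.Dual.finrank_ker_add_one_of_ne_zero hne
  rw [Module.finrank_fin_fun] at hker
  omega
end
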